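/- Let Ω be a bounded domain with smooth boundary in ℝⁿ, τ > 0, and let λ_{i,τ} (i ≥ 1) be the non-zero eigenvalues of the fourth-order Steklov problem Δ̄²u − τΔ̄u = 0 in Ω, ∂²u/∂ν² = 0 on ∂Ω, τ ∂u/∂ν − div_{∂Ω}(∇̄²u(ν)) − ∂(Δ̄u)/∂ν = λu on ∂Ω, with L²(∂Ω)-orthonormal eigenfunctions. After translating and rotating the Euclidean coordinates x₁, …, xₙ so that ∫_{∂Ω} xᵢ uⱼ dσ = 0 for i = 1, …, n and j = 0, …, i−1, one has λ_{i,τ} ∫_{∂Ω} xᵢ² dσ ≤ τ|Ω| for each i = 1, …, n, and hence ∑_{i=1}^{n} λ_{i,τ} ∫_{∂Ω} xᵢ² dσ ≤ nτ|Ω|. -/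

import Mathlib

open MeasureTheory Metric Set
open scoped ENNReal RealInnerProductSpace

noncomputable section

/-- The `(n-1)`-dimensional Hausdorff (surface) measure on `ℝⁿ`. -/
def surfMeasure (n : ℕ) : Measure (EuclideanSpace ℝ (Fin n)) :=
  Measure.hausdorffMeasure ((n : ℝ) - 1)

/-- `Ω ⊆ ℝⁿ` has smooth boundary: near every boundary point, `Ω` is the open
region lying on one side of the graph of a smooth function. -/
def HasSmoothBoundary {n : ℕ} (Ω : Set (EuclideanSpace ℝ (Fin n))) : Prop :=
  ∀ p ∈ frontier Ω, ∃ r > (0:ℝ), ∃ e : EuclideanSpace ℝ (Fin n), ‖e‖ = 1 ∧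
    ∃ f : EuclideanSpace ℝ (Fin n) → ℝ, ContDiff ℝ (⊤ : ℕ∞) f ∧
      ∀ y ∈ ball p r, (y ∈ Ω ↔ f (y - ⟪y, e⟫ • e) < ⟪y, e⟫)

/-- `ν` is the outward unit normal field along `∂Ω`. -/
def IsOuterNormal {n : ℕ} (Ω : Set (EuclideanSpace ℝ (Fin n)))
    (ν : EuclideanSpace ℝ (Fin n) → EuclideanSpace ℝ (Fin n)) : Prop :=
  ∀ p ∈ frontier Ω, ‖ν p‖ = 1 ∧ ∃ ε > (0:ℝ), ∀ t ∈ Ioo (0:ℝ) ε,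
    p + t • ν p ∉ closure Ω ∧ p - t • ν p ∈ Ω

/-- Tangential gradient along a hypersurface with unit normal `ν`. -/
def tGrad {n : ℕ} (ν : EuclideanSpace ℝ (Fin n) → EuclideanSpace ℝ (Fin n))
    (f : EuclideanSpace ℝ (Fin n) → ℝ) (x : EuclideanSpace ℝ (Fin n)) :
    EuclideanSpace ℝ (Fin n) :=
  gradient f x - ⟪gradient f x, ν x⟫ • ν x

/-- Tangential divergence of an ambient vector field along a hypersurface with
unit normal `ν`. -/
def tDiv {n : ℕ} (ν X : EuclideanSpace ℝ (Fin n) → EuclideanSpace ℝ (Fin n))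
    (p : EuclideanSpace ℝ (Fin n)) : ℝ :=
  (∑ i, ⟪fderiv ℝ X p (EuclideanSpace.single i 1), EuclideanSpace.single i 1⟫)
    - ⟪fderiv ℝ X p (ν p), ν p⟫

/-- `H` is the (normalized) mean curvature vector of the hypersurface `S` with
unit normal `ν`, characterized by the first variation formula
`∫_S div_S X = -(n-1) ∫_S ⟨X, H⟩` for all smooth ambient vector fields `X`. -/
def IsMeanCurvature {n : ℕ} (S : Set (EuclideanSpace ℝ (Fin n)))
    (ν H : EuclideanSpace ℝ (Fin n) → EuclideanSpace ℝ (Fin n)) : Prop :=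
  ∀ X : EuclideanSpace ℝ (Fin n) → EuclideanSpace ℝ (Fin n), ContDiff ℝ (⊤ : ℕ∞) X →
    ∫ p in S, tDiv ν X p ∂(surfMeasure n)
      = -((n : ℝ) - 1) * ∫ p in S, ⟪X p, H p⟫ ∂(surfMeasure n)

/-- Second partial derivative `∂²f/∂xᵢ∂xⱼ`. -/
def hess {n : ℕ} (f : EuclideanSpace ℝ (Fin n) → ℝ) (x : EuclideanSpace ℝ (Fin n))
    (i j : Fin n) : ℝ :=
  fderiv ℝ (fun y => fderiv ℝ f y (EuclideanSpace.single j 1)) x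
    (EuclideanSpace.single i 1)

/-- Squared Frobenius norm of the Hessian, `|∇̄²f|² = ∑_{i,j} (∂²f/∂xᵢ∂xⱼ)²`. -/
def hessSq {n : ℕ} (f : EuclideanSpace ℝ (Fin n) → ℝ)
    (x : EuclideanSpace ℝ (Fin n)) : ℝ :=
  ∑ i, ∑ j, hess f x i j ^ 2

theorem hasFDerivAt_coord {n : ℕ} (i : Fin n) (x : EuclideanSpace ℝ (Fin n)) :
    HasFDerivAt (fun y : EuclideanSpace ℝ (Fin n) => y i)
      (EuclideanSpace.proj (𝕜 := ℝ) i : EuclideanSpace ℝ (Fin n) →L[ℝ] ℝ) x :=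
  (EuclideanSpace.proj (𝕜 := ℝ) i : EuclideanSpace ℝ (Fin n) →L[ℝ] ℝ).hasFDerivAt

theorem hessSq_coord {n : ℕ} (i : Fin n) (x : EuclideanSpace ℝ (Fin n)) :
    hessSq (fun y => y i) x = 0 := by
  simp [hessSq, hess, (hasFDerivAt_coord i _).fderiv]

theorem gradient_coord {n : ℕ} (i : Fin n) (x : EuclideanSpace ℝ (Fin n)) :
    gradient (fun y => y i) x = EuclideanSpace.single i 1 := by
  refine ext_inner_right ℝ fun v => ?_
  rw [gradient, (hasFDerivAt_coord i x).fderiv, InnerProductSpace.toDual_symm_apply,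
    EuclideanSpace.inner_single_left]
  simp

/-- The numerator of the Rayleigh quotient of a coordinate function is `τ|Ω|`. -/
theorem integral_energy_coord {n : ℕ} (τ : ℝ) (Ω : Set (EuclideanSpace ℝ (Fin n))) (i : Fin n) :
    ∫ x in Ω, (hessSq (fun y => y i) x + τ * ‖gradient (fun y => y i) x‖ ^ 2)
      = τ * (volume Ω).toReal := by
  simp [hessSq_coord, gradient_coord, Measure.real, mul_comm]

/-- **Key estimate in the proof of Theorem 1.6.**  With the fourth-order
Steklov eigenvalues `0 = λ₀ < λ₁ ≤ ⋯` of `Ω` (variational characterization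
with orthonormal eigenfunctions `u j`), if the Euclidean coordinates have been
translated and rotated so that `∫_{∂Ω} xᵢ u_j = 0` for `i = 1, …, n` and
`j = 0, …, i-1` (with the zero-based coordinate `z ↦ z i` playing the role of
`x_{i+1}`), then `λᵢ ∫_{∂Ω} xᵢ² ≤ τ|Ω|` for each `i`, and hence
`∑_{i=1}^n λᵢ ∫_{∂Ω} xᵢ² ≤ n τ |Ω|`. -/
theorem biharmonic_steklov_coordinate_estimates
    (n : ℕ) (hn : 2 ≤ n) (τ : ℝ) (hτ : 0 < τ)
    (Ω : Set (EuclideanSpace ℝ (Fin n)))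
    (hopen : IsOpen Ω) (hconn : IsConnected Ω) (hbdd : Bornology.IsBounded Ω)
    (hsmooth : HasSmoothBoundary Ω)
    (u : ℕ → EuclideanSpace ℝ (Fin n) → ℝ) (lam : ℕ → ℝ)
    (horth : ∀ i j, ∫ x in frontier Ω, u i x * u j x ∂(surfMeasure n)
        = if i = j then 1 else 0)
    (hmin : ∀ k, IsLeast
      {R : ℝ | ∃ v : EuclideanSpace ℝ (Fin n) → ℝ, ContDiff ℝ (⊤ : ℕ∞) v ∧
        0 < ∫ x in frontier Ω, v x ^ 2 ∂(surfMeasure n) ∧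
        (∀ j < k, ∫ x in frontier Ω, v x * u j x ∂(surfMeasure n) = 0) ∧
        R = (∫ x in Ω, (hessSq v x + τ * ‖gradient v x‖ ^ 2)) /
            ∫ x in frontier Ω, v x ^ 2 ∂(surfMeasure n)} (lam k))
    (hl0 : lam 0 = 0) (hl1 : 0 < lam 1)
    (hcoord : ∀ i : Fin n, ∀ j : ℕ, j ≤ (i : ℕ) →
      ∫ x in frontier Ω, x i * u j x ∂(surfMeasure n) = 0) :
    (∀ i : Fin n, lam ((i : ℕ) + 1) * ∫ x in frontier Ω, (x i) ^ 2 ∂(surfMeasure n)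
        ≤ τ * (volume Ω).toReal)
    ∧ (∑ i : Fin n, lam ((i : ℕ) + 1) * ∫ x in frontier Ω, (x i) ^ 2 ∂(surfMeasure n))
        ≤ (n : ℝ) * τ * (volume Ω).toReal := by
  have coord_le : ∀ i : Fin n,
      lam ((i : ℕ) + 1) * ∫ x in frontier Ω, (x i) ^ 2 ∂(surfMeasure n)
        ≤ τ * (volume Ω).toReal := by
    intro i
    have norm_nonneg : 0 ≤ ∫ x in frontier Ω, (x i) ^ 2 ∂(surfMeasure n) :=
      integral_nonneg fun x => sq_nonneg _
    rcases norm_nonneg.eq_or_lt with h | h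
    · rw [← h, mul_zero]
      positivity
    · rw [← le_div_iff₀ h]
      refine (hmin ((i : ℕ) + 1)).2 ⟨fun x => x i, ?_, h,
        fun j hj => hcoord i j (Nat.lt_succ_iff.mp hj), ?_⟩
      · exact (EuclideanSpace.proj (𝕜 := ℝ) i : EuclideanSpace ℝ (Fin n) →L[ℝ] ℝ).contDiff
      · rw [integral_energy_coord]
  refine ⟨coord_le, (Finset.sum_le_sum fun i _ => coord_le i).trans_eq ?_⟩
  simp [mul_assoc]
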